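/- (Energy inequality.) Let Q : ℝ³ × [0,∞) → 𝒬₀ be a classical solution of the relaxed Q-tensor flow satisfying the constancy-outside-a-compact-set condition, and suppose the initial data Q₀(x) = Q(x,0) takes values in 𝒩 for every x ∈ ℝ³. Then for every t ≥ 0, ∫₀ᵗ ∫_{ℝ³} |∂ₛQ(x,s)|² dx ds + ∫_{ℝ³} [ f̃_B(Q(x,t))/(εΓ) + (L₁/(2Γ)) |∇Q(x,t)|² ] dx ≤ (L₁/(2Γ)) ∫_{ℝ³} |∇Q₀(x)|² dx. -/

import Mathlib

open Matrix Finset MeasureTheory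

noncomputable section

abbrev Mat := Matrix (Fin 3) (Fin 3) ℝ
abbrev Vec3 := Fin 3 → ℝ

/-- Spatial partial derivative `∂_k f`. -/
def pd (k : Fin 3) (f : Vec3 → ℝ) : Vec3 → ℝ := fun x => fderiv ℝ f x (Pi.single k 1)

/-- Spatial Laplacian `Δf = Σ_k ∂_k ∂_k f`. -/
def lap (f : Vec3 → ℝ) (x : Vec3) : ℝ := ∑ k : Fin 3, pd k (pd k f) x

/-- `|∇Q|²(x,t) = Σ_{k,i,j} (∂_k Q_{ij})²`. -/
def gradSq (Q : Vec3 → ℝ → Mat) (x : Vec3) (t : ℝ) : ℝ :=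
  ∑ k : Fin 3, ∑ i : Fin 3, ∑ j : Fin 3, pd k (fun y => Q y t i j) x ^ 2

def frob (A B : Mat) : ℝ := ∑ i : Fin 3, ∑ j : Fin 3, A i j * B i j
def mnormSq (A : Mat) : ℝ := frob A A
def sPlus (a b c : ℝ) : ℝ := (b + Real.sqrt (b ^ 2 + 24 * a * c)) / (4 * c)
def Jmap (a b c : ℝ) (Q : Mat) : Mat :=
  (a - c * mnormSq Q) • Q + b • (Q * Q) - (b / 3 * mnormSq Q) • (1 : Mat)
def fB (a b c : ℝ) (Q : Mat) : ℝ :=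
  -(a / 2) * mnormSq Q - b / 3 * (Q * Q * Q).trace + c / 4 * mnormSq Q ^ 2
def ftB (a b c : ℝ) (Q : Mat) : ℝ :=
  fB a b c Q + a * sPlus a b c ^ 2 / 3 + 2 * b * sPlus a b c ^ 3 / 27 - c * sPlus a b c ^ 4 / 9
def NSet (a b c : ℝ) : Set Mat :=
  {Q | ∃ n : Vec3, n ⬝ᵥ n = 1 ∧ Q = sPlus a b c • (vecMulVec n n - (1 / 3 : ℝ) • (1 : Mat))}

/-- `Q` is a classical solution of the relaxed Q-tensor flow
`∂ₜQ = (1/(εΓ)) J(Q) + (L₁/Γ) ΔQ` for times `t ∈ I`. -/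
def IsSolution (a b c Γ L1 ε : ℝ) (Q : Vec3 → ℝ → Mat) (I : Set ℝ) : Prop :=
  (∀ i j : Fin 3, ContDiff ℝ (⊤ : ℕ∞) fun p : Vec3 × ℝ => Q p.1 p.2 i j) ∧
    ∀ (x : Vec3), ∀ t ∈ I, ∀ i j : Fin 3,
      deriv (fun s => Q x s i j) t =
        1 / (ε * Γ) * Jmap a b c (Q x t) i j + L1 / Γ * lap (fun y => Q y t i j) x

/-- Constancy outside a compact set: `Q(x,t) = A ∈ 𝒩` for `x` outside a compact set `K`. -/
def ConstOutside (a b c : ℝ) (Q : Vec3 → ℝ → Mat) (I : Set ℝ) : Prop :=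
  ∃ A ∈ NSet a b c, ∃ K : Set Vec3, IsCompact K ∧ ∀ x ∉ K, ∀ t ∈ I, Q x t = A

/-- The energy density `e_ε(Q,∇Q) = f̃_B(Q)/(εΓ) + (L₁/(2Γ))|∇Q|²`. -/
def eDens (a b c Γ L1 ε : ℝ) (Q : Vec3 → ℝ → Mat) (x : Vec3) (t : ℝ) : ℝ :=
  ftB a b c (Q x t) / (ε * Γ) + L1 / (2 * Γ) * gradSq Q x t

/-- The scaled backward heat kernel `G_{z₀}(x,t)`. -/
def Gk (Γ L1 : ℝ) (x₀ : Vec3) (t₀ : ℝ) (x : Vec3) (t : ℝ) : ℝ :=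
  (4 * Real.pi * (L1 / Γ) * (t₀ - t)) ^ (-(3 : ℝ) / 2) *
    Real.exp (-(∑ i : Fin 3, (x i - x₀ i) ^ 2) / (4 * (L1 / Γ) * (t₀ - t)))

/-- The space-time directional derivative of `F` along `v`. -/
def dirDeriv (v : Vec3 × ℝ) (F : Vec3 × ℝ → ℝ) : Vec3 × ℝ → ℝ := fun p => fderiv ℝ F p v

abbrev spaceDir (k : Fin 3) : Vec3 × ℝ := (Pi.single k 1, 0)

abbrev timeDir : Vec3 × ℝ := (0, 1)

section dirDeriv

variable {F G : Vec3 × ℝ → ℝ}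

lemma contDiff_dirDeriv (hF : ContDiff ℝ (⊤ : ℕ∞) F) (v : Vec3 × ℝ) :
    ContDiff ℝ (⊤ : ℕ∞) (dirDeriv v F) :=
  (hF.fderiv_right (m := (⊤ : ℕ∞)) (by simp)).clm_apply contDiff_const

lemma differentiable_of_contDiff_top (hF : ContDiff ℝ (⊤ : ℕ∞) F) : Differentiable ℝ F :=
  hF.differentiable (by simp)

lemma dirDeriv_comm (hF : ContDiff ℝ (⊤ : ℕ∞) F) (v w : Vec3 × ℝ) :
    dirDeriv v (dirDeriv w F) = dirDeriv w (dirDeriv v F) := by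
  have hd : Differentiable ℝ (fderiv ℝ F) :=
    (hF.fderiv_right (m := (⊤ : ℕ∞)) (by simp)).differentiable (by simp)
  have key : ∀ (u : Vec3 × ℝ) (p : Vec3 × ℝ),
      fderiv ℝ (fun q => fderiv ℝ F q u) p = (fderiv ℝ (fderiv ℝ F) p).flip u := by
    intro u p
    rw [fderiv_clm_apply (hd p) (differentiableAt_const u)]
    simp
  funext p
  have hs : IsSymmSndFDerivAt ℝ F p :=
    hF.contDiffAt.isSymmSndFDerivAt (by
      rw [minSmoothness_of_isRCLikeNormedField]; exact WithTop.coe_le_coe.2 le_top)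
  change fderiv ℝ (fun q => fderiv ℝ F q w) p v = fderiv ℝ (fun q => fderiv ℝ F q v) p w
  rw [key, key]
  exact hs v w

lemma pd_slice (hF : Differentiable ℝ F) (k : Fin 3) (t : ℝ) (x : Vec3) :
    pd k (fun y => F (y, t)) x = dirDeriv (spaceDir k) F (x, t) := by
  have h : HasFDerivAt (fun y : Vec3 => (y, t)) (ContinuousLinearMap.inl ℝ Vec3 ℝ) x := by
    exact hasFDerivAt_prodMk_left x t
  have h2 := (hF (x, t)).hasFDerivAt.comp x h
  change fderiv ℝ (F ∘ fun y => (y, t)) x (Pi.single k 1) = _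
  rw [h2.fderiv]
  simp [dirDeriv]

lemma hasDerivAt_slice (hF : Differentiable ℝ F) (x : Vec3) (t : ℝ) :
    HasDerivAt (fun s => F (x, s)) (dirDeriv timeDir F (x, t)) t := by
  have h : HasFDerivAt (fun s : ℝ => (x, s)) (ContinuousLinearMap.inr ℝ Vec3 ℝ) t :=
    hasFDerivAt_prodMk_right x t
  have h2 := ((hF (x, t)).hasFDerivAt.comp t h).hasDerivAt
  simp only [ContinuousLinearMap.comp_apply, ContinuousLinearMap.inr_apply] at h2
  exact h2

lemma lap_slice (hF : ContDiff ℝ (⊤ : ℕ∞) F) (x : Vec3) (t : ℝ) :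
    lap (fun y => F (y, t)) x =
      ∑ k, dirDeriv (spaceDir k) (dirDeriv (spaceDir k) F) (x, t) := by
  unfold lap
  refine Finset.sum_congr rfl fun k _ => ?_
  rw [show pd k (fun y => F (y, t)) = fun y => dirDeriv (spaceDir k) F (y, t) from
    funext fun y => pd_slice (differentiable_of_contDiff_top hF) k t y]
  exact pd_slice (differentiable_of_contDiff_top (contDiff_dirDeriv hF _)) k t x

lemma dirDeriv_mul (hF : Differentiable ℝ F) (hG : Differentiable ℝ G) (v p : Vec3 × ℝ) :
    dirDeriv v (fun q => F q * G q) p = dirDeriv v F p * G p + F p * dirDeriv v G p := by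
  unfold dirDeriv
  rw [fderiv_fun_mul (hF p) (hG p)]
  simp
  ring

lemma dirDeriv_sub (hF : Differentiable ℝ F) (hG : Differentiable ℝ G) (v : Vec3 × ℝ) :
    dirDeriv v (fun q => F q - G q) = fun p => dirDeriv v F p - dirDeriv v G p := by
  funext p
  unfold dirDeriv
  rw [fderiv_fun_sub (hF p) (hG p)]
  simp

lemma dirDeriv_sum {ι : Type*} [Fintype ι] {F : ι → Vec3 × ℝ → ℝ}
    (hF : ∀ i, Differentiable ℝ (F i)) (v : Vec3 × ℝ) :
    dirDeriv v (fun q => ∑ i, F i q) = fun p => ∑ i, dirDeriv v (F i) p := by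
  funext p
  unfold dirDeriv
  rw [fderiv_fun_sum fun i _ => hF i p]
  simp

lemma dirDeriv_eq_zero_of_eventuallyEq_const {p : Vec3 × ℝ} {C : ℝ}
    (h : F =ᶠ[nhds p] fun _ => C) (v : Vec3 × ℝ) : dirDeriv v F p = 0 := by
  unfold dirDeriv
  rw [h.fderiv_eq]
  simp

/-- A function that is constant outside a spatial compact set for nonnegative times has vanishing
derivatives there at positive times. -/
lemma dirDeriv_eq_zero_outside {K : Set Vec3} (hK : IsCompact K) {C : ℝ}
    (hz : ∀ x ∉ K, ∀ s, 0 ≤ s → F (x, s) = C) (v : Vec3 × ℝ) {x : Vec3} (hx : x ∉ K)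
    {s : ℝ} (hs : 0 < s) : dirDeriv v F (x, s) = 0 := by
  refine dirDeriv_eq_zero_of_eventuallyEq_const (C := C) ?_ v
  filter_upwards [(hK.isClosed.isOpen_compl.prod isOpen_Ioi).mem_nhds
    (show (x, s) ∈ Kᶜ ×ˢ Set.Ioi (0 : ℝ) from ⟨hx, hs⟩)] with p hp
  exact hz p.1 hp.1 p.2 (le_of_lt hp.2)

lemma dirDeriv_space_eq_zero_outside (hF : Differentiable ℝ F) {K : Set Vec3} (hK : IsCompact K)
    {C : ℝ} {s : ℝ} (hz : ∀ x ∉ K, F (x, s) = C) (k : Fin 3) {x : Vec3} (hx : x ∉ K) :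
    dirDeriv (spaceDir k) F (x, s) = 0 := by
  rw [← pd_slice hF]
  unfold pd
  have : (fun y => F (y, s)) =ᶠ[nhds x] fun _ => C := by
    filter_upwards [hK.isClosed.isOpen_compl.mem_nhds hx] with y hy using hz y hy
  rw [this.fderiv_eq]
  simp

lemma integrable_slice (hF : Continuous F) {K : Set Vec3} (hK : IsCompact K) {s : ℝ}
    (hz : ∀ x ∉ K, F (x, s) = 0) : Integrable fun x => F (x, s) :=
  (hF.comp (by fun_prop : Continuous fun x : Vec3 => (x, s))).integrable_of_hasCompactSupport
    (HasCompactSupport.intro hK hz)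

lemma integrable_dirDeriv_space (hF : ContDiff ℝ (⊤ : ℕ∞) F) {K : Set Vec3} (hK : IsCompact K)
    {s : ℝ} (hz : ∀ x ∉ K, F (x, s) = 0) (k : Fin 3) :
    Integrable fun x => dirDeriv (spaceDir k) F (x, s) :=
  integrable_slice (contDiff_dirDeriv hF _).continuous hK fun _ hx =>
    dirDeriv_space_eq_zero_outside (differentiable_of_contDiff_top hF) hK hz k hx

lemma integral_dirDeriv_space_eq_zero (hF : ContDiff ℝ (⊤ : ℕ∞) F) {K : Set Vec3}
    (hK : IsCompact K) {s : ℝ} (hz : ∀ x ∉ K, F (x, s) = 0) (k : Fin 3) :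
    ∫ x, dirDeriv (spaceDir k) F (x, s) = 0 := by
  have hd := differentiable_of_contDiff_top hF
  have h1 : Integrable fun x => dirDeriv (spaceDir k) F (x, s) :=
    integrable_dirDeriv_space hF hK hz k
  have h2 : Integrable fun x => F (x, s) := integrable_slice hF.continuous hK hz
  have h3 : ∀ x, fderiv ℝ (fun y => F (y, s)) x (Pi.single k 1) =
    dirDeriv (spaceDir k) F (x, s) := fun x => pd_slice hd k s x
  have h := integral_mul_fderiv_eq_neg_fderiv_mul_of_integrable (μ := (volume : Measure Vec3))
    (f := fun _ => (1 : ℝ)) (g := fun y => F (y, s)) (v := Pi.single k 1) (by simp)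
    (by simpa [h3] using h1) (by simpa using h2) (fun x _ => differentiableAt_const _)
    (fun x _ => (hd (x, s)).comp x (by fun_prop))
  simpa [h3] using h

lemma integral_slice_sub (hF : ContDiff ℝ (⊤ : ℕ∞) F) {K : Set Vec3} (hK : IsCompact K)
    (hz : ∀ x ∉ K, ∀ s, 0 ≤ s → F (x, s) = 0) {T : ℝ} (hT : 0 ≤ T) :
    (∫ x, F (x, T)) - ∫ x, F (x, 0) =
      ∫ s in Set.Ioc 0 T, ∫ x, dirDeriv timeDir F (x, s) := by
  have hd := differentiable_of_contDiff_top hF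
  have hc : Continuous (dirDeriv timeDir F) := (contDiff_dirDeriv hF _).continuous
  rw [← integral_sub (integrable_slice hF.continuous hK fun x hx => hz x hx T hT)
    (integrable_slice hF.continuous hK fun x hx => hz x hx 0 le_rfl)]
  have ftc : ∀ x, F (x, T) - F (x, 0) = ∫ s in Set.Ioc 0 T, dirDeriv timeDir F (x, s) := by
    intro x
    rw [← intervalIntegral.integral_of_le hT]
    refine (intervalIntegral.integral_eq_sub_of_hasDerivAt
      (fun s _ => hasDerivAt_slice hd x s) ?_).symm
    exact (hc.comp (by fun_prop : Continuous fun s : ℝ => (x, s))).intervalIntegrable _ _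
  simp_rw [ftc]
  refine integral_integral_swap (f := fun x s => dirDeriv timeDir F (x, s)) ?_
  have hon : IntegrableOn (dirDeriv timeDir F) (Set.univ ×ˢ Set.Ioc 0 T)
      ((volume : Measure Vec3).prod (volume : Measure ℝ)) := by
    refine IntegrableOn.of_forall_sdiff_eq_zero
      (hc.continuousOn.integrableOn_compact (hK.prod (isCompact_Icc (a := (0 : ℝ)) (b := T))))
      (MeasurableSet.univ.prod measurableSet_Ioc) ?_
    rintro ⟨x, s⟩ ⟨⟨-, hs⟩, hn⟩
    refine dirDeriv_eq_zero_outside hK hz _ (fun hx => hn ⟨hx, Set.Ioc_subset_Icc_self hs⟩) hs.1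
  rw [IntegrableOn, ← Measure.prod_restrict, Measure.restrict_univ] at hon
  exact hon

end dirDeriv

/-- Uniqueness for linear parabolic systems `∂ₜu = κ Δu + B u` among spatially compactly supported
smooth functions. -/
theorem eq_zero_of_linear_parabolic {ι : Type*} [Fintype ι] {u : ι → Vec3 × ℝ → ℝ}
    (hu : ∀ i, ContDiff ℝ (⊤ : ℕ∞) (u i)) {K : Set Vec3} (hK : IsCompact K)
    (hz : ∀ i, ∀ x ∉ K, ∀ s, 0 ≤ s → u i (x, s) = 0) (h0 : ∀ i x, u i (x, 0) = 0)
    {κ : ℝ} (hκ : 0 ≤ κ) {B : ι → ι → Vec3 × ℝ → ℝ} (hB : ∀ i j, Continuous (B i j))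
    (heq : ∀ i x s, 0 ≤ s → dirDeriv timeDir (u i) (x, s) =
      κ * ∑ k, dirDeriv (spaceDir k) (dirDeriv (spaceDir k) (u i)) (x, s) +
        ∑ j, B i j (x, s) * u j (x, s))
    (i : ι) (x : Vec3) {T : ℝ} (hT : 0 ≤ T) : u i (x, T) = 0 := by
  have hd : ∀ i, Differentiable ℝ (u i) := fun i => differentiable_of_contDiff_top (hu i)
  obtain ⟨M, hM⟩ := (hK.prod (isCompact_Icc (a := (0 : ℝ)) (b := T))).exists_bound_of_continuousOn
    (f := fun p => ∑ i, ∑ j, |B i j p|)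
    (continuous_finsetSum _ fun i _ => continuous_finsetSum _ fun j _ =>
      (hB i j).abs).continuousOn
  set C : ℝ := M * Fintype.card ι with hC
  set S : Vec3 × ℝ → ℝ := fun p => ∑ i, u i p * u i p with hS
  have hSsm : ContDiff ℝ (⊤ : ℕ∞) S := ContDiff.sum fun i _ => (hu i).mul (hu i)
  set w : Vec3 × ℝ → ℝ := fun p => Real.exp (-2 * C * p.2) with hw
  have hwsm : ContDiff ℝ (⊤ : ℕ∞) w := by fun_prop
  set h : Vec3 × ℝ → ℝ := fun p => w p * S p with hh
  have hsm : ContDiff ℝ (⊤ : ℕ∞) h := hwsm.mul hSsm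
  have hhz : ∀ x ∉ K, ∀ s, 0 ≤ s → h (x, s) = 0 := by
    intro x hx s hs
    simp [hh, hS, hz _ x hx s hs]
  have hwt : ∀ p, dirDeriv timeDir w p = -2 * C * w p := by
    rintro ⟨x, s⟩
    have h1 := hasDerivAt_slice (differentiable_of_contDiff_top hwsm) x s
    have h2 : HasDerivAt (fun s => w (x, s)) (Real.exp (-2 * C * s) * (-2 * C * 1)) s :=
      ((hasDerivAt_id s).const_mul (-2 * C)).exp
    rw [h1.unique h2]
    simp only [hw]
    ring
  have hreact : ∀ x, ∀ s ∈ Set.Icc 0 T,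
      ∑ i, u i (x, s) * ∑ j, B i j (x, s) * u j (x, s) ≤ C * S (x, s) := by
    intro x s hs
    by_cases hx : x ∈ K
    swap
    · simp [hS, hz _ x hx s hs.1]
    have hb : ∀ i j, |B i j (x, s)| ≤ M := by
      intro i j
      refine le_trans ?_ ((le_abs_self _).trans (hM (x, s) ⟨hx, hs⟩))
      exact (Finset.single_le_sum (f := fun j => |B i j (x, s)|) (fun j _ => abs_nonneg _)
        (Finset.mem_univ j)).trans (Finset.single_le_sum (f := fun i => ∑ j, |B i j (x, s)|)
        (fun i _ => Finset.sum_nonneg fun j _ => abs_nonneg _) (Finset.mem_univ i))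
    have hterm : ∀ i j, u i (x, s) * (B i j (x, s) * u j (x, s)) ≤
        M / 2 * (u i (x, s) * u i (x, s)) + M / 2 * (u j (x, s) * u j (x, s)) := by
      intro i j
      obtain ⟨h1, h2⟩ := abs_le.1 (hb i j)
      nlinarith [mul_nonneg (sub_nonneg.2 h2) (sq_nonneg (u i (x, s) + u j (x, s))),
        mul_nonneg (neg_le_iff_add_nonneg.1 h1) (sq_nonneg (u i (x, s) - u j (x, s)))]
    calc ∑ i, u i (x, s) * ∑ j, B i j (x, s) * u j (x, s)
        ≤ ∑ i, ∑ j, (M / 2 * (u i (x, s) * u i (x, s)) + M / 2 * (u j (x, s) * u j (x, s))) := by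
          simp_rw [Finset.mul_sum]
          exact Finset.sum_le_sum fun i _ => Finset.sum_le_sum fun j _ => hterm i j
      _ = C * S (x, s) := by
          simp only [Finset.sum_add_distrib, Finset.sum_const, Finset.card_univ, nsmul_eq_mul,
            ← Finset.mul_sum, hC, hS]
          ring
  have hflux : ∀ i k, ContDiff ℝ (⊤ : ℕ∞) fun p => u i p * dirDeriv (spaceDir k) (u i) p :=
    fun i k => (hu i).mul (contDiff_dirDeriv (hu i) _)
  have hfz : ∀ i k s, 0 ≤ s → ∀ x ∉ K, u i (x, s) * dirDeriv (spaceDir k) (u i) (x, s) = 0 := by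
    intro i k s hs x hx
    rw [hz i x hx s hs, zero_mul]
  set D : Vec3 × ℝ → ℝ := fun p => 2 * κ * w p * ∑ i, ∑ k,
    dirDeriv (spaceDir k) (fun q => u i q * dirDeriv (spaceDir k) (u i) q) p with hD
  have hle : ∀ x, ∀ s ∈ Set.Icc 0 T, dirDeriv timeDir h (x, s) ≤ D (x, s) := by
    intro x s hs
    have hSt : dirDeriv timeDir S (x, s) =
        2 * ∑ i, u i (x, s) * dirDeriv timeDir (u i) (x, s) := by
      rw [hS, dirDeriv_sum (F := fun i q => u i q * u i q) fun i => (hd i).mul (hd i),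
        Finset.mul_sum]
      refine Finset.sum_congr rfl fun i _ => ?_
      rw [dirDeriv_mul (hd i) (hd i)]
      ring
    have hdiff : ∑ i, u i (x, s) *
          (κ * ∑ k, dirDeriv (spaceDir k) (dirDeriv (spaceDir k) (u i)) (x, s)) ≤
        κ * ∑ i, ∑ k,
          dirDeriv (spaceDir k) (fun q => u i q * dirDeriv (spaceDir k) (u i) q) (x, s) := by
      rw [Finset.mul_sum]
      refine Finset.sum_le_sum fun i _ => ?_
      rw [mul_left_comm, Finset.mul_sum]
      refine mul_le_mul_of_nonneg_left (Finset.sum_le_sum fun k _ => ?_) hκ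
      rw [dirDeriv_mul (hd i) (differentiable_of_contDiff_top (contDiff_dirDeriv (hu i) _))]
      nlinarith [mul_self_nonneg (dirDeriv (spaceDir k) (u i) (x, s))]
    have hsum : ∑ i, u i (x, s) * dirDeriv timeDir (u i) (x, s) =
        ∑ i, u i (x, s) *
          (κ * ∑ k, dirDeriv (spaceDir k) (dirDeriv (spaceDir k) (u i)) (x, s)) +
        ∑ i, u i (x, s) * ∑ j, B i j (x, s) * u j (x, s) := by
      rw [← Finset.sum_add_distrib]
      exact Finset.sum_congr rfl fun i _ => by rw [heq i x s hs.1, mul_add]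
    rw [hh, dirDeriv_mul (differentiable_of_contDiff_top hwsm)
      (differentiable_of_contDiff_top hSsm), hwt, hSt, hsum]
    have hwpos : 0 < w (x, s) := Real.exp_pos _
    have := mul_le_mul_of_nonneg_left (add_le_add hdiff (hreact x s hs)) hwpos.le
    simp only [hD]
    linarith
  have hDint : ∀ s, 0 ≤ s → Integrable fun x => D (x, s) := by
    intro s hs
    refine Integrable.const_mul (c := 2 * κ * Real.exp (-2 * C * s)) ?_
    exact integrable_finsetSum _ fun i _ => integrable_finsetSum _ fun k _ =>
      integrable_dirDeriv_space (hflux i k) hK (hfz i k s hs) k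
  have hDzero : ∀ s, 0 ≤ s → ∫ x, D (x, s) = 0 := by
    intro s hs
    have hi : ∀ i k, Integrable fun x => dirDeriv (spaceDir k)
        (fun q => u i q * dirDeriv (spaceDir k) (u i) q) (x, s) := fun i k =>
      integrable_dirDeriv_space (hflux i k) hK (hfz i k s hs) k
    simp only [hD, hw]
    rw [integral_const_mul,
      integral_finsetSum _ fun i _ => integrable_finsetSum _ fun k _ => hi i k,
      Finset.sum_eq_zero, mul_zero]
    intro i _
    rw [integral_finsetSum _ fun k _ => hi i k]
    exact Finset.sum_eq_zero fun k _ =>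
      integral_dirDeriv_space_eq_zero (hflux i k) hK (hfz i k s hs) k
  have hmain := integral_slice_sub hsm hK hhz hT
  have hinit : ∫ x, h (x, 0) = 0 := by simp [hh, hS, h0]
  have hrhs : ∫ s in Set.Ioc 0 T, ∫ x, dirDeriv timeDir h (x, s) ≤ 0 := by
    refine setIntegral_nonpos measurableSet_Ioc fun s hs => ?_
    rw [← hDzero s hs.1.le]
    refine integral_mono ?_ (hDint s hs.1.le) fun x => hle x s (Set.Ioc_subset_Icc_self hs)
    exact integrable_slice (contDiff_dirDeriv hsm _).continuous hK fun x hx =>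
      dirDeriv_eq_zero_outside hK hhz _ hx hs.1
  have hSnn : ∀ p, 0 ≤ S p := fun p => Finset.sum_nonneg fun i _ => mul_self_nonneg _
  by_contra hne
  have hpos : 0 < ∫ x, h (x, T) := by
    refine Continuous.integral_pos_of_hasCompactSupport_nonneg_nonzero (x := x)
      (hsm.continuous.comp (by fun_prop : Continuous fun x : Vec3 => (x, T)))
      (HasCompactSupport.intro hK fun x hx => hhz x hx T hT)
      (fun x => mul_nonneg (Real.exp_pos _).le (hSnn _)) ?_
    refine (mul_pos (Real.exp_pos _) ?_).ne'
    exact Finset.sum_pos' (fun i _ => mul_self_nonneg _)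
      ⟨i, Finset.mem_univ i, mul_self_pos.2 hne⟩
  linarith

section NSet

variable {a b c : ℝ} {A : Mat}

lemma NSet.symm (hA : A ∈ NSet a b c) (i j : Fin 3) : A i j = A j i := by
  obtain ⟨n, -, rfl⟩ := hA
  simp [vecMulVec_apply, Matrix.one_apply, mul_comm, eq_comm]

lemma NSet.trace (hA : A ∈ NSet a b c) : ∑ i, A i i = 0 := by
  obtain ⟨n, hn, rfl⟩ := hA
  simp only [dotProduct, Fin.sum_univ_three] at hn
  simp [vecMulVec_apply, Fin.sum_univ_three]
  linear_combination sPlus a b c * hn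

lemma NSet.ftB_eq_zero (hA : A ∈ NSet a b c) : ftB a b c A = 0 := by
  obtain ⟨n, hn, rfl⟩ := hA
  simp only [dotProduct, Fin.sum_univ_three] at hn
  generalize hs : sPlus a b c = s
  have hsq : mnormSq (s • (vecMulVec n n - (1 / 3 : ℝ) • (1 : Mat))) =
      s ^ 2 * ((n 0 * n 0 + n 1 * n 1 + n 2 * n 2) ^ 2 -
        2 / 3 * (n 0 * n 0 + n 1 * n 1 + n 2 * n 2) + 1 / 3) := by
    simp [mnormSq, frob, vecMulVec_apply, Fin.sum_univ_three]
    ring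
  have hcube : (s • (vecMulVec n n - (1 / 3 : ℝ) • (1 : Mat)) *
      s • (vecMulVec n n - (1 / 3 : ℝ) • (1 : Mat)) *
      s • (vecMulVec n n - (1 / 3 : ℝ) • (1 : Mat))).trace =
      s ^ 3 * ((n 0 * n 0 + n 1 * n 1 + n 2 * n 2) ^ 3 -
        (n 0 * n 0 + n 1 * n 1 + n 2 * n 2) ^ 2 +
        1 / 3 * (n 0 * n 0 + n 1 * n 1 + n 2 * n 2) - 1 / 9) := by
    simp only [Matrix.trace, Matrix.diag_apply, Matrix.mul_apply, Matrix.smul_apply,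
      Matrix.sub_apply, vecMulVec_apply, Matrix.one_apply, Fin.sum_univ_three, smul_eq_mul]
    simp
    ring
  rw [ftB, fB, hsq, hcube, hn, hs]
  ring

end NSet

lemma Jmap_sub_swap (a b c : ℝ) (A : Mat) (i j : Fin 3) :
    Jmap a b c A i j - Jmap a b c A j i = ∑ q : Fin 3 × Fin 3,
      ((if (i, j) = q then a - c * mnormSq A else 0) +
        b * ((if j = q.2 then A i q.1 else 0) + (if i = q.1 then A j q.2 else 0))) *
          (A q.1 q.2 - A q.2 q.1) := by
  simp only [Fintype.sum_prod_type, Jmap, Matrix.sub_apply, Matrix.add_apply, Matrix.smul_apply,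
    Matrix.mul_apply, smul_eq_mul, Prod.mk.injEq]
  fin_cases i <;> fin_cases j <;> simp [Fin.sum_univ_three] <;> ring

lemma sum_Jmap_diag (a b c : ℝ) {A : Mat} (hA : ∀ i j, A i j = A j i) :
    ∑ i, Jmap a b c A i i = (a - c * mnormSq A) * ∑ i, A i i := by
  simp only [Jmap, Matrix.sub_apply, Matrix.add_apply, Matrix.smul_apply,
    Matrix.mul_apply, smul_eq_mul]
  generalize hm : mnormSq A = m
  simp only [mnormSq, frob, Fin.sum_univ_three] at hm
  simp [Fin.sum_univ_three]
  rw [hA 1 0, hA 2 0, hA 2 1] at *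
  linear_combination b * hm

/-- Along symmetric traceless matrices, `J` is minus the gradient of the bulk energy. -/
lemma hasDerivAt_ftB (a b c : ℝ) {q : ℝ → Mat} {q' : Mat} {t : ℝ}
    (hq : ∀ i j, HasDerivAt (fun s => q s i j) (q' i j) t) (hsymm : ∀ i j, q t i j = q t j i)
    (hsymm' : ∀ i j, q' i j = q' j i) (htr' : ∑ i, q' i i = 0) :
    HasDerivAt (fun s => ftB a b c (q s)) (-frob (Jmap a b c (q t)) q') t := by
  have hn : HasDerivAt (fun s => mnormSq (q s))
      (∑ i, ∑ j, (q' i j * q t i j + q t i j * q' i j)) t := by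
    simp only [mnormSq, frob]
    exact HasDerivAt.fun_sum fun i _ => HasDerivAt.fun_sum fun j _ => (hq i j).fun_mul (hq i j)
  have hc : HasDerivAt (fun s => (q s * q s * q s).trace) (∑ i, ∑ j,
      ((∑ k, (q' i k * q t k j + q t i k * q' k j)) * q t j i +
        (∑ k, q t i k * q t k j) * q' j i)) t := by
    simp only [Matrix.trace, Matrix.diag_apply, Matrix.mul_apply]
    exact HasDerivAt.fun_sum fun i _ => HasDerivAt.fun_sum fun j _ =>
      (HasDerivAt.fun_sum fun k _ => (hq i k).fun_mul (hq k j)).fun_mul (hq j i)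
  have h := ((((((hn.const_mul (-(a / 2))).fun_sub (hc.const_mul (b / 3))).fun_add
    ((hn.fun_pow 2).const_mul (c / 4))).add_const (a * sPlus a b c ^ 2 / 3)).add_const
    (2 * b * sPlus a b c ^ 3 / 27)).sub_const (c * sPlus a b c ^ 4 / 9))
  refine h.congr_deriv ?_
  simp only [frob, Jmap, Matrix.sub_apply, Matrix.add_apply, Matrix.smul_apply,
    Matrix.mul_apply, smul_eq_mul]
  generalize mnormSq (q t) = m
  have htr : q' 2 2 = -q' 0 0 - q' 1 1 := by
    simp only [Fin.sum_univ_three] at htr'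
    linarith
  simp [Fin.sum_univ_three]
  rw [hsymm 1 0, hsymm 2 0, hsymm 2 1, hsymm' 1 0, hsymm' 2 0, hsymm' 2 1, htr]
  ring

section Solution

variable {a b c Γ L1 ε : ℝ} {Q : Vec3 → ℝ → Mat}

lemma continuous_mnormSq_comp (hQ : ∀ i j : Fin 3, Continuous fun p : Vec3 × ℝ => Q p.1 p.2 i j) :
    Continuous fun p : Vec3 × ℝ => mnormSq (Q p.1 p.2) := by
  unfold mnormSq frob
  exact continuous_finsetSum _ fun i _ => continuous_finsetSum _ fun j _ => (hQ i j).mul (hQ i j)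

lemma IsSolution.dirDeriv_time_eq (hsol : IsSolution a b c Γ L1 ε Q (Set.Ici 0)) (i j : Fin 3)
    (x : Vec3) {s : ℝ} (hs : 0 ≤ s) :
    dirDeriv timeDir (fun p => Q p.1 p.2 i j) (x, s) =
      1 / (ε * Γ) * Jmap a b c (Q x s) i j + L1 / Γ *
        ∑ k, dirDeriv (spaceDir k) (dirDeriv (spaceDir k) fun p => Q p.1 p.2 i j) (x, s) := by
  rw [← lap_slice (hsol.1 i j) x s,
    ← (hasDerivAt_slice (differentiable_of_contDiff_top (hsol.1 i j)) x s).deriv]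
  exact hsol.2 x s hs i j

/-- The flow preserves symmetry. -/
lemma IsSolution.symm (hsol : IsSolution a b c Γ L1 ε Q (Set.Ici 0))
    (hconst : ConstOutside a b c Q (Set.Ici 0)) (h0 : ∀ x : Vec3, Q x 0 ∈ NSet a b c)
    (hκ : 0 ≤ L1 / Γ) (x : Vec3) {s : ℝ} (hs : 0 ≤ s) (i j : Fin 3) : Q x s i j = Q x s j i := by
  obtain ⟨A, hA, K, hK, hout⟩ := hconst
  have hd : ∀ i j, Differentiable ℝ fun p : Vec3 × ℝ => Q p.1 p.2 i j :=
    fun i j => differentiable_of_contDiff_top (hsol.1 i j)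
  have hd' : ∀ i j k, Differentiable ℝ (dirDeriv (spaceDir k) fun p => Q p.1 p.2 i j) :=
    fun i j k => differentiable_of_contDiff_top (contDiff_dirDeriv (hsol.1 i j) _)
  have hmc : Continuous fun p : Vec3 × ℝ => mnormSq (Q p.1 p.2) :=
    continuous_mnormSq_comp fun i j => (hsol.1 i j).continuous
  refine sub_eq_zero.1 (eq_zero_of_linear_parabolic
    (u := fun (r : Fin 3 × Fin 3) (p : Vec3 × ℝ) => Q p.1 p.2 r.1 r.2 - Q p.1 p.2 r.2 r.1)
    (fun r => (hsol.1 _ _).sub (hsol.1 _ _)) hK ?_ ?_ hκ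
    (B := fun r q p => 1 / (ε * Γ) * ((if r = q then a - c * mnormSq (Q p.1 p.2) else 0) +
      b * ((if r.2 = q.2 then Q p.1 p.2 r.1 q.1 else 0) +
        (if r.1 = q.1 then Q p.1 p.2 r.2 q.2 else 0)))) ?_ ?_ (i, j) x hs)
  · intro r x hx s hs
    simp [hout x hx s hs, NSet.symm hA r.1 r.2]
  · intro r x
    simp [NSet.symm (h0 x) r.1 r.2]
  · intro r q
    have h1 := (hsol.1 r.1 q.1).continuous
    have h2 := (hsol.1 r.2 q.2).continuous
    split_ifs <;> fun_prop
  · rintro ⟨i, j⟩ x s hs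
    simp only [dirDeriv_sub (hd i j) (hd j i), dirDeriv_sub (hd' i j _) (hd' j i _),
      hsol.dirDeriv_time_eq _ _ x hs, Finset.sum_sub_distrib, mul_assoc]
    rw [← Finset.mul_sum, ← Jmap_sub_swap]
    ring

/-- The flow preserves tracelessness. -/
lemma IsSolution.trace_eq_zero (hsol : IsSolution a b c Γ L1 ε Q (Set.Ici 0))
    (hconst : ConstOutside a b c Q (Set.Ici 0)) (h0 : ∀ x : Vec3, Q x 0 ∈ NSet a b c)
    (hκ : 0 ≤ L1 / Γ) (x : Vec3) {s : ℝ} (hs : 0 ≤ s) : ∑ i, Q x s i i = 0 := by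
  have hsymm := fun x s hs => hsol.symm hconst h0 hκ x (s := s) hs
  obtain ⟨A, hA, K, hK, hout⟩ := hconst
  have hd : ∀ i j, Differentiable ℝ fun p : Vec3 × ℝ => Q p.1 p.2 i j :=
    fun i j => differentiable_of_contDiff_top (hsol.1 i j)
  have hd' : ∀ i j k, Differentiable ℝ (dirDeriv (spaceDir k) fun p => Q p.1 p.2 i j) :=
    fun i j k => differentiable_of_contDiff_top (contDiff_dirDeriv (hsol.1 i j) _)
  have hmc : Continuous fun p : Vec3 × ℝ => mnormSq (Q p.1 p.2) :=
    continuous_mnormSq_comp fun i j => (hsol.1 i j).continuous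
  refine eq_zero_of_linear_parabolic (ι := Unit)
    (u := fun _ (p : Vec3 × ℝ) => ∑ i, Q p.1 p.2 i i)
    (fun _ => ContDiff.sum fun i _ => hsol.1 i i) hK ?_ ?_ hκ
    (B := fun _ _ p => 1 / (ε * Γ) * (a - c * mnormSq (Q p.1 p.2))) ?_ ?_ () x hs
  · intro _ x hx s hs
    rw [hout x hx s hs, NSet.trace hA]
  · intro _ x
    exact NSet.trace (h0 x)
  · intro _ _
    fun_prop
  · intro _ x s hs
    simp only [dirDeriv_sum (F := fun i p => Q p.1 p.2 i i) fun i => hd i i,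
      dirDeriv_sum (F := fun i => dirDeriv (spaceDir _) fun p => Q p.1 p.2 i i) fun i => hd' i i _,
      hsol.dirDeriv_time_eq _ _ x hs, Finset.sum_add_distrib, ← Finset.mul_sum,
      sum_Jmap_diag a b c (hsymm x s hs), Finset.univ_unique, Finset.sum_const,
      Finset.card_singleton, one_smul]
    rw [Finset.sum_comm]
    ring

lemma contDiff_ftB_comp
    (hQ : ∀ i j : Fin 3, ContDiff ℝ (⊤ : ℕ∞) fun p : Vec3 × ℝ => Q p.1 p.2 i j) :
    ContDiff ℝ (⊤ : ℕ∞) fun p : Vec3 × ℝ => ftB a b c (Q p.1 p.2) := by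
  simp only [ftB, fB, mnormSq, frob, Matrix.trace, Matrix.diag_apply, Matrix.mul_apply]
  fun_prop

lemma eDens_slice (hQ : ∀ i j : Fin 3, ContDiff ℝ (⊤ : ℕ∞) fun p : Vec3 × ℝ => Q p.1 p.2 i j)
    (x : Vec3) (s : ℝ) :
    eDens a b c Γ L1 ε Q x s = ftB a b c (Q x s) / (ε * Γ) + L1 / (2 * Γ) *
      ∑ k, ∑ i, ∑ j, dirDeriv (spaceDir k) (fun p => Q p.1 p.2 i j) (x, s) ^ 2 := by
  unfold eDens gradSq
  congr 2
  refine Finset.sum_congr rfl fun k _ => Finset.sum_congr rfl fun i _ =>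
    Finset.sum_congr rfl fun j _ => ?_
  rw [← pd_slice (differentiable_of_contDiff_top (hQ i j))]

lemma contDiff_eDens (hQ : ∀ i j : Fin 3, ContDiff ℝ (⊤ : ℕ∞) fun p : Vec3 × ℝ => Q p.1 p.2 i j) :
    ContDiff ℝ (⊤ : ℕ∞) fun p : Vec3 × ℝ => eDens a b c Γ L1 ε Q p.1 p.2 := by
  simp only [eDens_slice hQ]
  exact ((contDiff_ftB_comp hQ).div_const _).add (contDiff_const.mul
    (ContDiff.sum fun k _ => ContDiff.sum fun i _ => ContDiff.sum fun j _ =>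
      (contDiff_dirDeriv (hQ i j) _).pow 2))

/-- The pointwise energy balance: the energy density changes by dissipation and a divergence. -/
lemma IsSolution.dirDeriv_time_eDens (hsol : IsSolution a b c Γ L1 ε Q (Set.Ici 0))
    (hconst : ConstOutside a b c Q (Set.Ici 0)) (h0 : ∀ x : Vec3, Q x 0 ∈ NSet a b c)
    (hκ : 0 ≤ L1 / Γ) (x : Vec3) {s : ℝ} (hs : 0 < s) :
    dirDeriv timeDir (fun p => eDens a b c Γ L1 ε Q p.1 p.2) (x, s) =
      L1 / Γ * (∑ i, ∑ j, ∑ k, dirDeriv (spaceDir k)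
        (fun p => dirDeriv (spaceDir k) (fun p => Q p.1 p.2 i j) p *
          dirDeriv timeDir (fun p => Q p.1 p.2 i j) p) (x, s)) -
      ∑ i, ∑ j, dirDeriv timeDir (fun p => Q p.1 p.2 i j) (x, s) ^ 2 := by
  have hd : ∀ i j, Differentiable ℝ fun p : Vec3 × ℝ => Q p.1 p.2 i j :=
    fun i j => differentiable_of_contDiff_top (hsol.1 i j)
  have hd' : ∀ v i j, Differentiable ℝ (dirDeriv v fun p => Q p.1 p.2 i j) :=
    fun v i j => differentiable_of_contDiff_top (contDiff_dirDeriv (hsol.1 i j) v)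
  have hq : ∀ i j, HasDerivAt (fun τ => Q x τ i j)
      (dirDeriv timeDir (fun p => Q p.1 p.2 i j) (x, s)) s := fun i j => hasDerivAt_slice (hd i j) x s
  have hev : ∀ᶠ τ in nhds s, 0 < τ := lt_mem_nhds hs
  have hsymm' : ∀ i j, dirDeriv timeDir (fun p => Q p.1 p.2 i j) (x, s) =
      dirDeriv timeDir (fun p => Q p.1 p.2 j i) (x, s) := fun i j =>
    (hq i j).unique ((hq j i).congr_of_eventuallyEq
      (hev.mono fun τ hτ => hsol.symm hconst h0 hκ x hτ.le i j))
  have htr' : ∑ i, dirDeriv timeDir (fun p => Q p.1 p.2 i i) (x, s) = 0 :=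
    (HasDerivAt.fun_sum (u := Finset.univ) fun i _ => hq i i).unique
      ((hasDerivAt_const s (0 : ℝ)).congr_of_eventuallyEq
        (hev.mono fun τ hτ => hsol.trace_eq_zero hconst h0 hκ x hτ.le))
  have hB := hasDerivAt_ftB a b c
    (q' := Matrix.of fun i j => dirDeriv timeDir (fun p => Q p.1 p.2 i j) (x, s)) hq
    (fun i j => hsol.symm hconst h0 hκ x hs.le i j) hsymm' htr'
  have hG := HasDerivAt.fun_sum (u := Finset.univ) fun (k : Fin 3) _ =>
    HasDerivAt.fun_sum (u := Finset.univ) fun (i : Fin 3) _ =>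
    HasDerivAt.fun_sum (u := Finset.univ) fun (j : Fin 3) _ =>
      (hasDerivAt_slice (hd' (spaceDir k) i j) x s).fun_pow 2
  have hE := (hB.div_const (ε * Γ)).fun_add (hG.const_mul (L1 / (2 * Γ)))
  simp only [← eDens_slice hsol.1] at hE
  rw [(hasDerivAt_slice (differentiable_of_contDiff_top (contDiff_eDens hsol.1)) x s).unique hE]
  have hflux : ∀ i j k, dirDeriv (spaceDir k)
      (fun p => dirDeriv (spaceDir k) (fun p => Q p.1 p.2 i j) p *
        dirDeriv timeDir (fun p => Q p.1 p.2 i j) p) (x, s) =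
      dirDeriv (spaceDir k) (dirDeriv (spaceDir k) fun p => Q p.1 p.2 i j) (x, s) *
        dirDeriv timeDir (fun p => Q p.1 p.2 i j) (x, s) +
      dirDeriv (spaceDir k) (fun p => Q p.1 p.2 i j) (x, s) *
        dirDeriv timeDir (dirDeriv (spaceDir k) fun p => Q p.1 p.2 i j) (x, s) := fun i j k => by
    rw [dirDeriv_mul (hd' _ i j) (hd' _ i j), dirDeriv_comm (hsol.1 i j) (spaceDir k) timeDir]
  have hsq : ∀ i j, dirDeriv timeDir (fun p => Q p.1 p.2 i j) (x, s) ^ 2 =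
      (1 / (ε * Γ) * Jmap a b c (Q x s) i j + L1 / Γ *
        ∑ k, dirDeriv (spaceDir k) (dirDeriv (spaceDir k) fun p => Q p.1 p.2 i j) (x, s)) *
          dirDeriv timeDir (fun p => Q p.1 p.2 i j) (x, s) := fun i j => by
    rw [← hsol.dirDeriv_time_eq i j x hs.le, sq]
  simp only [hflux, hsq, frob, Matrix.of_apply, Fin.sum_univ_three]
  ring

end Solution

/-- Energy inequality for the relaxed Q-tensor flow: for a classical solution on
`ℝ³ × [0,∞)`, constant outside a compact set, with initial data in `𝒩`,
`∫₀ᵗ∫ |∂ₛQ|² + ∫ [f̃_B(Q(t))/(εΓ) + (L₁/(2Γ))|∇Q(t)|²] ≤ (L₁/(2Γ)) ∫ |∇Q₀|²`. -/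
theorem energy_inequality
    (a b c Γ L1 ε : ℝ) (ha : 0 < a) (hb : 0 < b) (hc : 0 < c)
    (hΓ : 0 < Γ) (hL1 : 0 < L1) (hε : 0 < ε)
    (Q : Vec3 → ℝ → Mat)
    (hsol : IsSolution a b c Γ L1 ε Q (Set.Ici 0))
    (hconst : ConstOutside a b c Q (Set.Ici 0))
    (h0 : ∀ x : Vec3, Q x 0 ∈ NSet a b c)
    (t : ℝ) (ht : 0 ≤ t) :
    (∫ s in Set.Ioc (0 : ℝ) t, ∫ x : Vec3,
        ∑ i : Fin 3, ∑ j : Fin 3, deriv (fun τ => Q x τ i j) s ^ 2)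
      + ∫ x : Vec3, (ftB a b c (Q x t) / (ε * Γ) + L1 / (2 * Γ) * gradSq Q x t)
      ≤ L1 / (2 * Γ) * ∫ x : Vec3, gradSq Q x 0 := by
  have hκ : 0 ≤ L1 / Γ := (div_pos hL1 hΓ).le
  have hbalance := fun x s hs => hsol.dirDeriv_time_eDens hconst h0 hκ x (s := s) hs
  obtain ⟨A, hA, K, hK, hout⟩ := hconst
  have hd : ∀ i j, Differentiable ℝ fun p : Vec3 × ℝ => Q p.1 p.2 i j :=
    fun i j => differentiable_of_contDiff_top (hsol.1 i j)
  have hflux : ∀ i j k, ContDiff ℝ (⊤ : ℕ∞) fun p =>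
      dirDeriv (spaceDir k) (fun p => Q p.1 p.2 i j) p *
        dirDeriv timeDir (fun p => Q p.1 p.2 i j) p := fun i j k =>
    (contDiff_dirDeriv (hsol.1 i j) _).mul (contDiff_dirDeriv (hsol.1 i j) _)
  have htz : ∀ i j s, 0 < s → ∀ x ∉ K,
      dirDeriv timeDir (fun p => Q p.1 p.2 i j) (x, s) = 0 := fun i j s hs x hx =>
    dirDeriv_eq_zero_outside hK (C := A i j) (fun x hx s hs => by simp [hout x hx s hs]) _ hx hs
  have hfz : ∀ i j k s, 0 < s → ∀ x ∉ K,
      dirDeriv (spaceDir k) (fun p => Q p.1 p.2 i j) (x, s) *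
        dirDeriv timeDir (fun p => Q p.1 p.2 i j) (x, s) = 0 := fun i j k s hs x hx => by
    rw [htz i j s hs x hx, mul_zero]
  have hEz : ∀ x ∉ K, ∀ s, 0 ≤ s → eDens a b c Γ L1 ε Q x s = 0 := by
    intro x hx s hs
    have hgrad : ∀ i j k, dirDeriv (spaceDir k) (fun p => Q p.1 p.2 i j) (x, s) = 0 :=
      fun i j k => dirDeriv_space_eq_zero_outside (hd i j) hK (C := A i j)
        (fun y hy => by simp [hout y hy s hs]) k hx
    simp [eDens_slice hsol.1, hgrad, hout x hx s hs, NSet.ftB_eq_zero hA]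
  have hdiss : ∀ s ∈ Set.Ioc 0 t,
      ∫ x, dirDeriv timeDir (fun p => eDens a b c Γ L1 ε Q p.1 p.2) (x, s) =
        -∫ x, ∑ i, ∑ j, deriv (fun τ => Q x τ i j) s ^ 2 := by
    intro s hs
    have hi : ∀ i j k, Integrable fun x => dirDeriv (spaceDir k)
        (fun p => dirDeriv (spaceDir k) (fun p => Q p.1 p.2 i j) p *
          dirDeriv timeDir (fun p => Q p.1 p.2 i j) p) (x, s) := fun i j k =>
      integrable_dirDeriv_space (hflux i j k) hK (hfz i j k s hs.1) k
    have hi3 : ∀ i j, Integrable fun x => ∑ k, dirDeriv (spaceDir k)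
        (fun p => dirDeriv (spaceDir k) (fun p => Q p.1 p.2 i j) p *
          dirDeriv timeDir (fun p => Q p.1 p.2 i j) p) (x, s) := fun i j =>
      integrable_finsetSum _ fun k _ => hi i j k
    have hi2 : ∀ i, Integrable fun x => ∑ j, ∑ k, dirDeriv (spaceDir k)
        (fun p => dirDeriv (spaceDir k) (fun p => Q p.1 p.2 i j) p *
          dirDeriv timeDir (fun p => Q p.1 p.2 i j) p) (x, s) := fun i =>
      integrable_finsetSum _ fun j _ => hi3 i j
    have hsq : Integrable fun x =>
        ∑ i, ∑ j, dirDeriv timeDir (fun p => Q p.1 p.2 i j) (x, s) ^ 2 := by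
      refine integrable_finsetSum _ fun i _ => integrable_finsetSum _ fun j _ => ?_
      refine integrable_slice (F := fun p => dirDeriv timeDir (fun p => Q p.1 p.2 i j) p ^ 2)
        ((contDiff_dirDeriv (hsol.1 i j) _).continuous.pow 2) hK fun x hx => ?_
      simp [htz i j s hs.1 x hx]
    have hderiv : ∀ x i j, deriv (fun τ => Q x τ i j) s =
        dirDeriv timeDir (fun p => Q p.1 p.2 i j) (x, s) := fun x i j =>
      (hasDerivAt_slice (hd i j) x s).deriv
    simp only [hderiv, hbalance _ s hs.1]
    rw [integral_sub ((integrable_finsetSum _ fun i _ => hi2 i).const_mul _) hsq,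
      integral_const_mul, integral_finsetSum _ fun i _ => hi2 i, Finset.sum_eq_zero, mul_zero,
      zero_sub]
    intro i _
    rw [integral_finsetSum _ fun j _ => hi3 i j]
    refine Finset.sum_eq_zero fun j _ => ?_
    rw [integral_finsetSum _ fun k _ => hi i j k]
    exact Finset.sum_eq_zero fun k _ =>
      integral_dirDeriv_space_eq_zero (hflux i j k) hK (hfz i j k s hs.1) k
  have hmain := integral_slice_sub (contDiff_eDens hsol.1) hK hEz ht
  rw [setIntegral_congr_fun measurableSet_Ioc hdiss, integral_neg] at hmain
  have hinit : ∫ x, eDens a b c Γ L1 ε Q x 0 = L1 / (2 * Γ) * ∫ x, gradSq Q x 0 := by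
    simp [eDens, NSet.ftB_eq_zero (h0 _), integral_const_mul]
  simp only [hinit] at hmain
  simp only [eDens] at hmain
  linarith
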